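/- arXiv:0906.4135 — 12 statements merged into one kernel-verified Lean document; each statement's English description precedes it below -/
import Mathlib

section
/- Let 0 < r < 1 and set θ = arccos r ∈ (0, π/2). Then the hyperbolic area of the geodesic halfdisk above {y = 1} bounded by the Euclidean circle of center (0,1) and radius r, namely 2·∫₀^r ∫₁^{1+√(r²−x²)} (1/y²) dy dx, equals 2θ/sin θ − π + 2·cos θ. -/
open Real intervalIntegral

/-- The hyperbolic length density integrates along a vertical segment from height `1` to `1 + s`. -/
lemma integral_one_div_sq_from_one {s : ℝ} (hs : 0 ≤ s) :
    ∫ y in (1 : ℝ)..(1 + s), 1 / y ^ 2 = 1 - 1 / (1 + s) := by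
  have hpos : ∀ y ∈ Set.uIcc (1 : ℝ) (1 + s), y ≠ 0 := by
    intro y hy
    rw [Set.uIcc_of_le (by linarith)] at hy
    linarith [hy.1]
  rw [integral_eq_sub_of_hasDerivAt (f := fun y => -y⁻¹)]
  · norm_num
    ring
  · intro y hy
    exact (hasDerivAt_inv (hpos y hy)).neg.congr_deriv (by simp)
  · exact (continuousOn_const.div (continuousOn_id.pow 2)
      fun y hy => pow_ne_zero 2 (hpos y hy)).intervalIntegrable

/-- An antiderivative of `1 - 1 / (1 + √(r² - x²))`. -/
lemma hasDerivAt_halfdisk_primitive {r x : ℝ} (hr0 : 0 < r) (hr1 : r < 1)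
    (hx0 : 0 < x) (hxr : x < r) :
    HasDerivAt (fun x => x - arcsin (x / r) +
        arctan (√(1 - r ^ 2) * x / (r ^ 2 + √(r ^ 2 - x ^ 2))) / √(1 - r ^ 2))
      (1 - 1 / (1 + √(r ^ 2 - x ^ 2))) x := by
  have hc2 : 0 < 1 - r ^ 2 := by nlinarith
  have hs2 : 0 < r ^ 2 - x ^ 2 := by nlinarith
  have hsqrt : HasDerivAt (fun x => √(r ^ 2 - x ^ 2)) (-x / √(r ^ 2 - x ^ 2)) x := by
    refine ((((hasDerivAt_id' x).pow 2).const_sub (r ^ 2)).sqrt hs2.ne').congr_deriv ?_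
    simp only [Pi.pow_apply]
    field_simp
    norm_num
  have hroot : √(1 - (x / r) ^ 2) = √(r ^ 2 - x ^ 2) / r := by
    rw [show 1 - (x / r) ^ 2 = (r ^ 2 - x ^ 2) / r ^ 2 by field_simp, sqrt_div hs2.le,
      sqrt_sq hr0.le]
  have hxr1 : x / r < 1 := (div_lt_one hr0).2 hxr
  have harcsin : HasDerivAt (fun x => arcsin (x / r)) (1 / √(r ^ 2 - x ^ 2)) x := by
    refine ((hasDerivAt_arcsin (by linarith [div_pos hx0 hr0]) hxr1.ne).comp x
      ((hasDerivAt_id' x).div_const r)).congr_deriv ?_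
    rw [hroot]
    field_simp
  have hs := sqrt_pos.2 hs2
  have hss := sq_sqrt hs2.le
  have hc := sqrt_pos.2 hc2
  have hcc := sq_sqrt hc2.le
  have hD : 0 < r ^ 2 + √(r ^ 2 - x ^ 2) := by positivity
  have harctan := ((((hasDerivAt_id' x).const_mul √(1 - r ^ 2)).div (hsqrt.const_add (r ^ 2))
    hD.ne').arctan).div_const √(1 - r ^ 2)
  refine (((hasDerivAt_id' x).sub harcsin).add harctan).congr_deriv ?_
  simp only [Pi.div_apply]
  generalize √(r ^ 2 - x ^ 2) = s at *
  generalize √(1 - r ^ 2) = c at *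
  have hnum : 1 + (c * x / (r ^ 2 + s)) ^ 2 = r ^ 2 * (1 + s) ^ 2 / (r ^ 2 + s) ^ 2 := by
    rw [div_pow, mul_pow, hcc, show x ^ 2 = r ^ 2 - s ^ 2 by linarith]
    field_simp
    ring
  have hder : c * 1 * (r ^ 2 + s) - c * x * (-x / s) = c * (r ^ 2 * (1 + s)) / s := by
    field_simp
    linear_combination hss
  rw [hnum, hder]
  field_simp
  ring

/-- For `0 < r < 1` and `θ = arccos r ∈ (0, π/2)`, the hyperbolic area of the
geodesic halfdisk above `{y = 1}` bounded by the Euclidean circle of center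
`(0,1)` and radius `r` is `2∫₀^r ∫₁^{1+√(r²−x²)} dy/y² dx = 2θ/sin θ − π + 2 cos θ`. -/
theorem geodesic_halfdisk_area (r : ℝ) (hr0 : 0 < r) (hr1 : r < 1)
    (θ : ℝ) (hθ : θ = Real.arccos r) :
    2 * (∫ x in (0:ℝ)..r, ∫ y in (1:ℝ)..(1 + Real.sqrt (r ^ 2 - x ^ 2)), 1 / y ^ 2) =
      2 * θ / Real.sin θ - π + 2 * Real.cos θ := by
  have hcont : Continuous fun x : ℝ => 1 - 1 / (1 + √(r ^ 2 - x ^ 2)) :=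
    continuous_const.sub (continuous_const.div (by fun_prop) fun x => by positivity)
  have hprim : Continuous fun x => x - arcsin (x / r) +
      arctan (√(1 - r ^ 2) * x / (r ^ 2 + √(r ^ 2 - x ^ 2))) / √(1 - r ^ 2) :=
    (continuous_id.sub (continuous_arcsin.comp (by fun_prop))).add
      ((continuous_arctan.comp (Continuous.div (by fun_prop) (by fun_prop)
        fun x => by positivity)).div_const _)
  simp_rw [integral_one_div_sq_from_one (sqrt_nonneg _)]
  rw [integral_eq_sub_of_hasDerivAt_of_le hr0.le hprim.continuousOn
    (fun x hx => hasDerivAt_halfdisk_primitive hr0 hr1 hx.1 hx.2)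
    (hcont.intervalIntegrable _ _)]
  have hquot : √(1 - r ^ 2) * r / r ^ 2 = √(1 - r ^ 2) / r := by field_simp
  rw [hθ, sin_arccos, cos_arccos (by linarith) hr1.le, arccos_eq_arctan hr0]
  simp only [sub_self, sqrt_zero, add_zero, hquot, div_self hr0.ne', arcsin_one, zero_div,
    mul_zero, arcsin_zero, arctan_zero, sub_zero]
  ring
end

section
/- Let c > 1, 0 < r < c, and set θ = arccos(r/c) ∈ (0, π/2). Then the hyperbolic area of the geodesic halfdisk below {y = c} bounded by the Euclidean circle of center (0,c) and radius r, namely 2·∫₀^r ∫_{c−√(r²−x²)}^{c} (1/y²) dy dx, equals 2(π − θ)/sin θ − π − 2·cos θ. -/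
open Real intervalIntegral

theorem arctan_one_add_cos_div_sin {θ : ℝ} (h0 : 0 < θ) (hπ : θ < π) :
    arctan ((1 + cos θ) / sin θ) = (π - θ) / 2 := by
  have hs : sin (θ / 2) ≠ 0 := (sin_pos_of_pos_of_lt_pi (by linarith) (by linarith)).ne'
  have hc : cos (θ / 2) ≠ 0 := (cos_pos_of_mem_Ioo ⟨by linarith, by linarith⟩).ne'
  have hcos : cos θ = 2 * cos (θ / 2) ^ 2 - 1 := by rw [← cos_two_mul]; ring_nf
  have hsin : sin θ = 2 * sin (θ / 2) * cos (θ / 2) := by rw [← sin_two_mul]; ring_nf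
  have h : (1 + cos θ) / sin θ = tan (π / 2 - θ / 2) := by
    rw [tan_pi_div_two_sub, tan_eq_sin_div_cos, hcos, hsin]
    field_simp
    ring
  rw [h, arctan_tan (by linarith) (by linarith)]
  ring

theorem one_sub_cos_mul_cos_pos {θ : ℝ} (hs : 0 < sin θ) (t : ℝ) : 0 < 1 - cos θ * cos t := by
  nlinarith [sq_nonneg (cos θ - cos t), sin_sq_add_cos_sq θ, sin_sq_add_cos_sq t, sq_nonneg (sin t),
    mul_pos hs hs]

theorem hasDerivAt_arctan_mul_sin_div_one_add_cos {θ t : ℝ} (hs : 0 < sin θ)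
    (ht : 0 < 1 + cos t) :
    HasDerivAt (fun t => 2 / sin θ * arctan ((1 + cos θ) / sin θ * (sin t / (1 + cos t))) - t)
      (cos θ * cos t / (1 - cos θ * cos t)) t := by
  have hq : HasDerivAt (fun t => sin t / (1 + cos t)) (1 / (1 + cos t)) t := by
    refine ((hasDerivAt_sin t).div ((hasDerivAt_cos t).const_add 1) ht.ne').congr_deriv ?_
    field_simp
    linarith [sin_sq_add_cos_sq t]
  have hd := one_sub_cos_mul_cos_pos hs t
  have hθ : 0 < 1 + cos θ := by nlinarith [sin_sq_add_cos_sq θ, neg_one_le_cos θ, mul_pos hs hs]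
  refine ((((hq.const_mul ((1 + cos θ) / sin θ)).arctan).const_mul (2 / sin θ)).sub
    (hasDerivAt_id t)).congr_deriv ?_
  have hk : 1 + ((1 + cos θ) / sin θ * (sin t / (1 + cos t))) ^ 2
      = 2 * (1 + cos θ) * (1 - cos θ * cos t) / (sin θ ^ 2 * (1 + cos t)) := by
    field_simp
    rw [sin_sq θ, sin_sq t]
    ring
  rw [hk]
  field_simp
  ring

theorem integral_cos_mul_cos_div_one_sub {θ : ℝ} (h0 : 0 < θ) (hπ : θ < π) :
    ∫ t in (0 : ℝ)..(π / 2), cos θ * cos t / (1 - cos θ * cos t) =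
      (π - θ) / sin θ - π / 2 := by
  have hs : 0 < sin θ := sin_pos_of_pos_of_lt_pi h0 hπ
  rw [integral_eq_sub_of_hasDerivAt
    (f := fun t => 2 / sin θ * arctan ((1 + cos θ) / sin θ * (sin t / (1 + cos t))) - t)]
  · simp only [sin_pi_div_two, cos_pi_div_two, sin_zero, add_zero, div_one, mul_one, zero_div,
      mul_zero, arctan_zero, sub_zero, arctan_one_add_cos_div_sin h0 hπ]
    ring
  · intro t ht
    rw [Set.uIcc_of_le (by positivity)] at ht
    have : 0 ≤ cos t := cos_nonneg_of_mem_Icc ⟨by linarith [ht.1, pi_pos], ht.2⟩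
    exact hasDerivAt_arctan_mul_sin_div_one_add_cos hs (by linarith)
  · exact (Continuous.div (by fun_prop) (by fun_prop)
      fun t => (one_sub_cos_mul_cos_pos hs t).ne').intervalIntegrable _ _

theorem integral_one_div_sq {a b : ℝ} (ha : 0 < a) (hab : a ≤ b) :
    ∫ y in a..b, 1 / y ^ 2 = 1 / a - 1 / b := by
  have hpos : ∀ y ∈ Set.uIcc a b, y ≠ 0 := fun y hy => by
    rw [Set.uIcc_of_le hab] at hy
    exact (ha.trans_le hy.1).ne'
  rw [integral_eq_sub_of_hasDerivAt (f := fun y => -y⁻¹)]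
  · ring
  · intro y hy
    exact (hasDerivAt_inv (hpos y hy)).neg.congr_deriv (by simp)
  · exact (continuousOn_const.div (by fun_prop)
      fun y hy => pow_ne_zero 2 (hpos y hy)).intervalIntegrable

/-- For `c > 1`, `0 < r < c` and `θ = arccos (r/c) ∈ (0, π/2)`, the hyperbolic
area of the geodesic halfdisk below `{y = c}` bounded by the Euclidean circle
of center `(0,c)` and radius `r` is
`2∫₀^r ∫_{c−√(r²−x²)}^c dy/y² dx = 2(π − θ)/sin θ − π − 2 cos θ`. -/
theorem lower_geodesic_halfdisk_area (c r : ℝ) (hc : 1 < c) (hr0 : 0 < r) (hrc : r < c)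
    (θ : ℝ) (hθ : θ = Real.arccos (r / c)) :
    2 * (∫ x in (0:ℝ)..r, ∫ y in (c - Real.sqrt (r ^ 2 - x ^ 2))..c, 1 / y ^ 2) =
      2 * (π - θ) / Real.sin θ - π - 2 * Real.cos θ := by
  have hc0 : 0 < c := by linarith
  have hlt : r / c < 1 := (div_lt_one hc0).2 hrc
  have hpos : 0 < r / c := by positivity
  have hcos : cos θ = r / c := by rw [hθ, cos_arccos (by linarith) hlt.le]
  have hr : r = c * cos θ := by rw [hcos]; field_simp
  have h0 : 0 < θ := hθ ▸ arccos_pos.2 hlt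
  have hπ : θ < π := by linarith [hθ ▸ arccos_lt_pi_div_two.2 hpos, pi_pos]
  have hsqrt (x : ℝ) : 0 < c - √(r ^ 2 - x ^ 2) := by
    have : √(r ^ 2 - x ^ 2) ≤ r := sqrt_le_iff.2 ⟨hr0.le, by nlinarith [sq_nonneg x]⟩
    linarith
  have hcont : Continuous fun x : ℝ => 1 / (c - √(r ^ 2 - x ^ 2)) :=
    continuous_const.div (by fun_prop) fun x => (hsqrt x).ne'
  have hsubst : ∫ x in (0 : ℝ)..r, 1 / (c - √(r ^ 2 - x ^ 2)) =
      ∫ t in (0 : ℝ)..(π / 2), cos θ * cos t / (1 - cos θ * cos t) := by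
    have h := integral_comp_mul_deriv (a := 0) (b := π / 2) (f := fun t => r * sin t)
      (f' := fun t => r * cos t) (g := fun x => 1 / (c - √(r ^ 2 - x ^ 2)))
      (fun t _ => (hasDerivAt_sin t).const_mul r) (by fun_prop) hcont
    simp only [sin_zero, mul_zero, sin_pi_div_two, mul_one] at h
    rw [← h]
    refine integral_congr fun t ht => ?_
    rw [Set.uIcc_of_le (by positivity)] at ht
    have hct : 0 ≤ cos t := cos_nonneg_of_mem_Icc ⟨by linarith [ht.1, pi_pos], ht.2⟩
    have hroot : √(r ^ 2 - (r * sin t) ^ 2) = r * cos t := by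
      rw [show r ^ 2 - (r * sin t) ^ 2 = (r * cos t) ^ 2 by rw [mul_pow, mul_pow, sin_sq]; ring,
        sqrt_sq (by positivity)]
    have hd := one_sub_cos_mul_cos_pos (sin_pos_of_pos_of_lt_pi h0 hπ) t
    simp only [Function.comp_apply, hroot]
    rw [hr, show c - c * cos θ * cos t = c * (1 - cos θ * cos t) by ring]
    field_simp
  simp_rw [fun x => integral_one_div_sq (hsqrt x) (sub_le_self c (sqrt_nonneg _))]
  rw [integral_sub (hcont.intervalIntegrable _ _) (by simp), hsubst,
    integral_cos_mul_cos_div_one_sub h0 hπ, integral_const, hcos, smul_eq_mul]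
  ring
end

section
/- Let r > 1. Then the hyperbolic length of the Euclidean semicircle of center (0,1) and radius r lying above {y = 1}, namely ∫₀^π r/(1 + r·sin t) dt, equals (2r/√(r² − 1))·ln(r + √(r² − 1)). Equivalently, writing α ∈ (0, π/2) with sin α = 1/r, this length equals (2/cos α)·ln(1/sin α + cot α). -/
open Real intervalIntegral

/-- The Weierstrass substitution gives an explicit primitive of `r / (1 + r * sin t)`
on `[0, π]`. -/
lemma hasDerivAt_log_half_angle {r s : ℝ} (hs : 0 < s) (hsr : s < r)
    (hrs : s ^ 2 = r ^ 2 - 1) {t : ℝ} (ht : t ∈ Set.Icc 0 π) :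
    HasDerivAt (fun x : ℝ => r / s *
      (log (sin (x / 2) + (r - s) * cos (x / 2)) - log (sin (x / 2) + (r + s) * cos (x / 2))))
      (r / (1 + r * sin t)) t := by
  have pos : ∀ a : ℝ, 0 < a → 0 < sin (t / 2) + a * cos (t / 2) := by
    intro a ha
    have hc : 0 ≤ cos (t / 2) :=
      cos_nonneg_of_mem_Icc ⟨by linarith [ht.1, pi_pos], by linarith [ht.2]⟩
    rcases ht.1.eq_or_lt with h | h
    · simpa [← h] using ha
    · have := sin_pos_of_pos_of_lt_pi (x := t / 2) (by linarith) (by linarith [ht.2, pi_pos])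
      positivity
  have deriv : ∀ a : ℝ, HasDerivAt (fun x : ℝ => sin (x / 2) + a * cos (x / 2))
      (cos (t / 2) * (1 / 2) + a * (-sin (t / 2) * (1 / 2))) t := by
    intro a
    have h := (hasDerivAt_id t).div_const 2
    exact h.sin.add (h.cos.const_mul a)
  have hN := pos (r - s) (by linarith)
  have hD := pos (r + s) (by linarith)
  have hsq := sin_sq_add_cos_sq (t / 2)
  have hprod : (sin (t / 2) + (r - s) * cos (t / 2)) * (sin (t / 2) + (r + s) * cos (t / 2))
      = 1 + r * sin t := by
    have h2 : sin t = 2 * sin (t / 2) * cos (t / 2) := by rw [← sin_two_mul]; ring_nf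
    rw [h2]
    linear_combination hsq - cos (t / 2) ^ 2 * hrs
  refine ((((deriv (r - s)).log hN.ne').sub ((deriv (r + s)).log hD.ne')).const_mul
    (r / s)).congr_deriv ?_
  rw [← hprod, div_sub_div _ _ hN.ne' hD.ne', div_mul_div_comm,
    div_eq_div_iff (mul_pos hs (mul_pos hN hD)).ne' (mul_pos hN hD).ne']
  linear_combination r * s * ((sin (t / 2) + (r - s) * cos (t / 2)) *
    (sin (t / 2) + (r + s) * cos (t / 2))) * hsq

/-- The value of `∫₀^π r / (1 + r sin t) dt` for `r > 1`. -/
lemma integral_div_one_add_mul_sin {r : ℝ} (hr : 1 < r) :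
    (∫ t in (0:ℝ)..π, r / (1 + r * sin t)) =
      2 * r / √(r ^ 2 - 1) * log (r + √(r ^ 2 - 1)) := by
  have hs : 0 < √(r ^ 2 - 1) := sqrt_pos.2 (by nlinarith)
  have hrs : √(r ^ 2 - 1) ^ 2 = r ^ 2 - 1 := sq_sqrt (by nlinarith)
  set s := √(r ^ 2 - 1)
  have hsr : s < r := by nlinarith
  have hint : IntervalIntegrable (fun t => r / (1 + r * sin t)) MeasureTheory.volume 0 π := by
    refine ContinuousOn.intervalIntegrable ?_
    rw [Set.uIcc_of_le pi_pos.le]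
    refine ContinuousOn.div (by fun_prop) (by fun_prop) fun t ht => ?_
    have := sin_nonneg_of_mem_Icc ht
    positivity
  rw [integral_eq_sub_of_hasDerivAt (fun t ht => hasDerivAt_log_half_angle hs hsr hrs
    (by rwa [Set.uIcc_of_le pi_pos.le] at ht)) hint]
  have hinv : r - s = (r + s)⁻¹ := eq_inv_of_mul_eq_one_left (by linear_combination -hrs)
  simp only [sin_pi_div_two, cos_pi_div_two, zero_div, sin_zero, cos_zero, mul_zero, add_zero,
    zero_add, mul_one, log_one, hinv, log_inv]
  ring

/-- For `r > 1`, the hyperbolic length of the Euclidean semicircle of center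
`(0,1)` and radius `r` above `{y = 1}` is
`∫₀^π r/(1 + r sin t) dt = (2r/√(r²−1))·log(r + √(r²−1))`; equivalently, with
`α ∈ (0, π/2)` satisfying `sin α = 1/r`, it equals
`(2/cos α)·log(1/sin α + cot α)`. -/
theorem equidistant_halfdisk_perimeter (r : ℝ) (hr : 1 < r) :
    (∫ t in (0:ℝ)..π, r / (1 + r * Real.sin t)) =
      2 * r / Real.sqrt (r ^ 2 - 1) * Real.log (r + Real.sqrt (r ^ 2 - 1)) ∧
    ∀ α : ℝ, α ∈ Set.Ioo 0 (π / 2) → Real.sin α = 1 / r →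
      (∫ t in (0:ℝ)..π, r / (1 + r * Real.sin t)) =
        2 / Real.cos α * Real.log (1 / Real.sin α + Real.cos α / Real.sin α) := by
  refine ⟨integral_div_one_add_mul_sin hr, fun α hα hsin => ?_⟩
  have hs : 0 < sin α := sin_pos_of_pos_of_lt_pi hα.1 (by linarith [hα.2, pi_pos])
  have hc : 0 < cos α := cos_pos_of_mem_Ioo ⟨by linarith [hα.1, pi_pos], hα.2⟩
  have hr' : r = 1 / sin α := by rw [hsin, one_div_one_div]
  have hsqrt : √(r ^ 2 - 1) = cos α / sin α := by
    rw [← sqrt_sq (div_pos hc hs).le]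
    congr 1
    rw [hr']
    field_simp
    linear_combination -sin_sq_add_cos_sq α
  rw [integral_div_one_add_mul_sin hr, hsqrt, hr']
  congr 1
  field_simp
end

section
/- Let θ₁, θ₂ ∈ (0, π/2) satisfy θ₁·cot θ₁ = π·cot θ₂. Then 2θ₁/sin θ₁ + 2·cos θ₁ − π > 2π/sin θ₂ − 2π. -/
open Real

/-- A quadratic lower bound for the secant on `[0, 1]`. -/
lemma one_add_half_sq_mul_cos_le_one {u : ℝ} (hu0 : 0 ≤ u) (hu1 : u ≤ 1) :
    (1 + u ^ 2 / 2) * cos u ≤ 1 := by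
  have hb := (abs_le.mp (Real.cos_bound (x := u) (by rw [abs_of_nonneg hu0]; exact hu1))).2
  rw [abs_of_nonneg hu0] at hb
  have hcos : cos u ≤ 1 - u ^ 2 / 2 + u ^ 4 * (5 / 96) := by linarith
  have hsq : u ^ 2 ≤ 1 := pow_le_one₀ hu0 hu1
  calc (1 + u ^ 2 / 2) * cos u
      ≤ (1 + u ^ 2 / 2) * (1 - u ^ 2 / 2 + u ^ 4 * (5 / 96)) := by gcongr
    _ = 1 - u ^ 4 * (19 / 96 - 5 / 192 * u ^ 2) := by ring
    _ ≤ 1 := by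
      have : 0 ≤ u ^ 4 * (19 / 96 - 5 / 192 * u ^ 2) := mul_nonneg (by positivity) (by linarith)
      linarith

/-- The area comparison after clearing the square root, for small angles. -/
lemma area_comparison_of_le {t : ℝ} (ht0 : 0 < t) (ht : t ≤ 4 / 5) :
    3 * π ^ 2 / 4 <
      t ^ 2 + cos t ^ 2 + 2 * (t / sin t) * cos t + π * (t / sin t) + π * cos t := by
  have hp3 := pi_gt_d2
  have hp4 := pi_lt_d2
  have hs : 0 < sin t := sin_pos_of_pos_of_lt_pi ht0 (by linarith)
  have hr : 1 ≤ t / sin t := (one_le_div hs).2 (sin_lt ht0).le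
  have hc : 1 - t ^ 2 / 2 ≤ cos t := one_sub_sq_div_two_le_cos
  have ht2 : t ^ 2 ≤ 16 / 25 := by nlinarith
  have hc2 : (1 - t ^ 2 / 2) ^ 2 ≤ cos t ^ 2 := pow_le_pow_left₀ (by linarith) hc 2
  have h1 : 1 - t ^ 2 / 2 ≤ t / sin t * cos t := by nlinarith
  have h2 : π ≤ π * (t / sin t) := le_mul_of_one_le_right pi_pos.le hr
  have h3 : π * (1 - t ^ 2 / 2) ≤ π * cos t := mul_le_mul_of_nonneg_left hc pi_pos.le
  have h4 : π * t ^ 2 ≤ π * (16 / 25) := mul_le_mul_of_nonneg_left ht2 pi_pos.le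
  have h5 : π ^ 2 ≤ 3.15 ^ 2 := pow_le_pow_left₀ pi_pos.le hp4.le 2
  nlinarith [sq_nonneg (t ^ 2)]

/-- The area comparison after clearing the square root, for large angles, written in terms of the
complementary angle `u`. -/
lemma area_comparison_compl_of_le {u : ℝ} (hu0 : 0 < u) (hu : u ≤ 39 / 50) :
    3 * π ^ 2 / 4 <
      (π / 2 - u) ^ 2 + sin u ^ 2 + 2 * ((π / 2 - u) / cos u) * sin u
        + π * ((π / 2 - u) / cos u) + π * sin u := by
  have hp3 := pi_gt_d2
  have hp4 := pi_lt_d2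
  have hc : 0 < cos u := cos_pos_of_mem_Ioo ⟨by linarith, by linarith⟩
  have hv : 0 < π / 2 - u := by linarith
  have hsec : 1 + u ^ 2 / 2 ≤ 1 / cos u :=
    (le_div_iff₀ hc).2 (one_add_half_sq_mul_cos_le_one hu0.le (by linarith))
  have htan : u ≤ sin u / cos u := by
    rw [← tan_eq_sin_div_cos]; exact le_tan hu0.le (by linarith)
  have hsin : u - u ^ 3 / 6 ≤ sin u := (sin_gt_sub_cube hu0).le
  have hsub : 0 ≤ u - u ^ 3 / 6 := by
    have : 0 ≤ u * (1 - u ^ 2 / 6) := mul_nonneg hu0.le (by nlinarith)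
    linarith
  have hsin2 : (u - u ^ 3 / 6) ^ 2 ≤ sin u ^ 2 := pow_le_pow_left₀ hsub hsin 2
  have h1 : (π / 2 - u) * u ≤ (π / 2 - u) / cos u * sin u := by
    calc (π / 2 - u) * u ≤ (π / 2 - u) * (sin u / cos u) := by gcongr
      _ = _ := by ring
  have h2 : π * ((π / 2 - u) * (1 + u ^ 2 / 2)) ≤ π * ((π / 2 - u) / cos u) := by
    calc π * ((π / 2 - u) * (1 + u ^ 2 / 2)) ≤ π * ((π / 2 - u) * (1 / cos u)) := by gcongr
      _ = _ := by ring
  have h3 : π * (u - u ^ 3 / 6) ≤ π * sin u := mul_le_mul_of_nonneg_left hsin pi_pos.le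
  have hfac : 0 < π ^ 2 / 4 - u ^ 2 / 3 - 2 * π * u / 3 := by
    have : π * u ≤ π * (39 / 50) := mul_le_mul_of_nonneg_left hu pi_pos.le
    nlinarith
  have h4 : 0 < u ^ 2 * (π ^ 2 / 4 - u ^ 2 / 3 - 2 * π * u / 3) := by positivity
  nlinarith [sq_nonneg (u ^ 3)]

/-- The area comparison after clearing the square root. -/
lemma area_comparison {t : ℝ} (ht0 : 0 < t) (ht : t < π / 2) :
    3 * π ^ 2 / 4 <
      t ^ 2 + cos t ^ 2 + 2 * (t / sin t) * cos t + π * (t / sin t) + π * cos t := by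
  rcases le_total t (4 / 5) with h | h
  · exact area_comparison_of_le ht0 h
  · have := area_comparison_compl_of_le (u := π / 2 - t) (by linarith)
      (by linarith [pi_lt_d2])
    simpa only [sin_pi_div_two_sub, cos_pi_div_two_sub, sub_sub_cancel] using this

/-- If a geodesic halfdisk above `{y=1}` with half-angle parameter `θ₁` and a
full geodesic disk with angle parameter `θ₂` have equal perimeter
(`θ₁·cot θ₁ = π·cot θ₂`), then the halfdisk has strictly larger area:
`2θ₁/sin θ₁ + 2 cos θ₁ − π > 2π/sin θ₂ − 2π`. -/
theorem halfdisk_area_gt_disk_area (θ₁ θ₂ : ℝ)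
    (h₁ : θ₁ ∈ Set.Ioo 0 (π / 2)) (h₂ : θ₂ ∈ Set.Ioo 0 (π / 2))
    (hper : θ₁ * Real.cot θ₁ = π * Real.cot θ₂) :
    2 * θ₁ / Real.sin θ₁ + 2 * Real.cos θ₁ - π > 2 * π / Real.sin θ₂ - 2 * π := by
  obtain ⟨ha, hb⟩ := h₁
  obtain ⟨hc, hd⟩ := h₂
  have hp := pi_pos
  have hs₁ : 0 < sin θ₁ := sin_pos_of_pos_of_lt_pi ha (by linarith)
  have hs₂ : 0 < sin θ₂ := sin_pos_of_pos_of_lt_pi hc (by linarith)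
  have hc₁ : 0 < cos θ₁ := cos_pos_of_mem_Ioo ⟨by linarith, hb⟩
  have hsq (a : ℝ) {x : ℝ} (hx : sin x ≠ 0) : (a / sin x) ^ 2 = a ^ 2 + (a * cot x) ^ 2 := by
    rw [cot_eq_cos_div_sin]
    field_simp
    rw [sin_sq_add_cos_sq, mul_one]
  have e₁ := hsq θ₁ hs₁.ne'
  have e₂ := hsq π hs₂.ne'
  rw [← hper] at e₂
  have key := area_comparison ha hb
  have hlt : π / sin θ₂ < θ₁ / sin θ₁ + cos θ₁ + π / 2 := by
    refine lt_of_pow_lt_pow_left₀ 2 (by positivity) ?_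
    nlinarith
  rw [mul_div_assoc, mul_div_assoc]
  linarith
end

section
/- For every θ ∈ (0, π/2), one has 2θ/sin θ + 2·cos θ + π > 2·√((θ/sin θ)² − θ² + π²); moreover the function A(θ) = 2θ/sin θ + 2·cos θ + π − 2·√((θ/sin θ)² − θ² + π²) is strictly decreasing on (0, π/2), tends to 4 + π − 2√(π² + 1) as θ → 0⁺, and tends to 0 as θ → π/2⁻. -/
open Real

/-- The area-difference function between a geodesic halfdisk and a geodesic
disk of the same perimeter. -/
noncomputable def areaDiff (θ : ℝ) : ℝ :=
  2 * θ / Real.sin θ + 2 * Real.cos θ + π -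
    2 * Real.sqrt ((θ / Real.sin θ) ^ 2 - θ ^ 2 + π ^ 2)

theorem hasDerivAt_areaDiff {θ : ℝ} (hs : Real.sin θ ≠ 0) :
    HasDerivAt areaDiff
      (2 * ((θ - Real.cos θ * Real.sin θ) / Real.sin θ ^ 2 *
        (θ * Real.cos θ / Real.sin θ / √((θ / Real.sin θ) ^ 2 - θ ^ 2 + π ^ 2) -
          Real.cos θ))) θ := by
  have hR : 0 < (θ / Real.sin θ) ^ 2 - θ ^ 2 + π ^ 2 := by
    have h : (θ / Real.sin θ) ^ 2 - θ ^ 2 = (θ * Real.cos θ / Real.sin θ) ^ 2 := by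
      field_simp
      rw [Real.cos_sq']
    rw [h]
    positivity
  have hquot := (hasDerivAt_id θ).div (Real.hasDerivAt_sin θ) hs
  have hsqrt := (((hquot.pow 2).sub ((hasDerivAt_id θ).pow 2)).add_const (π ^ 2)).sqrt hR.ne'
  have h := (((hquot.const_mul 2).add ((Real.hasDerivAt_cos θ).const_mul 2)).add_const π).sub
    (hsqrt.const_mul 2)
  refine (h.congr_of_eventuallyEq (.of_forall fun x => ?_)).congr_deriv ?_
  · simp [areaDiff, mul_div_assoc]
  · have hR' := Real.sqrt_pos.2 hR
    simp only [id, Pi.div_apply, Pi.pow_apply, Pi.sub_apply]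
    set R := √((θ / Real.sin θ) ^ 2 - θ ^ 2 + π ^ 2)
    have hc := Real.sin_sq_add_cos_sq θ
    field_simp
    simp only [Nat.cast_ofNat]
    norm_num
    generalize Real.sin θ = s at *
    generalize Real.cos θ = c at *
    grind

theorem continuousAt_areaDiff {θ : ℝ} (hs : Real.sin θ ≠ 0) : ContinuousAt areaDiff θ :=
  (hasDerivAt_areaDiff hs).continuousAt

theorem areaDiff_pi_div_two : areaDiff (π / 2) = 0 := by
  simp [areaDiff, Real.sqrt_sq pi_pos.le]
  ring

theorem strictAntiOn_areaDiff : StrictAntiOn areaDiff (Set.Ioc 0 (π / 2)) := by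
  have hsin : ∀ θ ∈ Set.Ioc 0 (π / 2), 0 < Real.sin θ := fun θ hθ =>
    Real.sin_pos_of_pos_of_lt_pi hθ.1 (by linarith [hθ.2, pi_pos])
  refine strictAntiOn_of_deriv_neg (convex_Ioc _ _)
    (fun θ hθ => (continuousAt_areaDiff (hsin θ hθ).ne').continuousWithinAt) fun θ hθ => ?_
  rw [interior_Ioc] at hθ
  have hs := hsin θ ⟨hθ.1, hθ.2.le⟩
  have hc : 0 < Real.cos θ := Real.cos_pos_of_mem_Ioo ⟨by linarith [hθ.1, pi_pos], hθ.2⟩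
  rw [(hasDerivAt_areaDiff hs.ne').deriv]
  have hlt : θ / Real.sin θ < √((θ / Real.sin θ) ^ 2 - θ ^ 2 + π ^ 2) :=
    Real.lt_sqrt_of_sq_lt (by nlinarith [hθ.1, hθ.2, pi_pos])
  have hR : 0 < √((θ / Real.sin θ) ^ 2 - θ ^ 2 + π ^ 2) := (div_pos hθ.1 hs).trans hlt
  have hneg : θ * Real.cos θ / Real.sin θ / √((θ / Real.sin θ) ^ 2 - θ ^ 2 + π ^ 2) -
      Real.cos θ < 0 := by
    rw [sub_neg, div_lt_iff₀ hR, mul_comm θ, mul_div_assoc]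
    gcongr
  have hpos : 0 < θ - Real.cos θ * Real.sin θ := by
    nlinarith [Real.sin_lt hθ.1, Real.cos_le_one θ]
  exact mul_neg_of_pos_of_neg two_pos (mul_neg_of_pos_of_neg (by positivity) hneg)

theorem tendsto_areaDiff_zero :
    Filter.Tendsto areaDiff (nhdsWithin 0 (Set.Ioi 0))
      (nhds (4 + π - 2 * √(π ^ 2 + 1))) := by
  have hcont : ContinuousAt (fun θ : ℝ => 2 / Real.sinc θ + 2 * Real.cos θ + π -
      2 * √((1 / Real.sinc θ) ^ 2 - θ ^ 2 + π ^ 2)) 0 := by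
    have h1 : ContinuousAt Real.sinc 0 := Real.continuous_sinc.continuousAt
    have h0 : Real.sinc 0 ≠ 0 := by simp
    fun_prop (disch := assumption)
  have h := hcont.tendsto.mono_left (nhdsWithin_le_nhds (s := Set.Ioi 0))
  have hval : (2 / Real.sinc 0 + 2 * Real.cos 0 + π -
      2 * √((1 / Real.sinc 0) ^ 2 - 0 ^ 2 + π ^ 2)) = 4 + π - 2 * √(π ^ 2 + 1) := by
    norm_num [add_comm]
  rw [hval] at h
  refine h.congr' ?_
  filter_upwards [self_mem_nhdsWithin] with θ hθ
  simp [areaDiff, Real.sinc_of_ne_zero (ne_of_gt hθ), div_div_eq_mul_div]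

/-- For every `θ ∈ (0, π/2)` one has
`2θ/sin θ + 2 cos θ + π > 2√((θ/sin θ)² − θ² + π²)`; moreover
`A(θ) = 2θ/sin θ + 2 cos θ + π − 2√((θ/sin θ)² − θ² + π²)` is strictly
decreasing on `(0, π/2)`, tends to `4 + π − 2√(π² + 1)` as `θ → 0⁺`, and tends
to `0` as `θ → π/2⁻`. -/
theorem areaDiff_pos_strictAnti_limits :
    (∀ θ ∈ Set.Ioo 0 (π / 2),
      2 * θ / Real.sin θ + 2 * Real.cos θ + π >
        2 * Real.sqrt ((θ / Real.sin θ) ^ 2 - θ ^ 2 + π ^ 2)) ∧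
    StrictAntiOn areaDiff (Set.Ioo 0 (π / 2)) ∧
    Filter.Tendsto areaDiff (nhdsWithin 0 (Set.Ioi 0))
      (nhds (4 + π - 2 * Real.sqrt (π ^ 2 + 1))) ∧
    Filter.Tendsto areaDiff (nhdsWithin (π / 2) (Set.Iio (π / 2))) (nhds 0) := by
  refine ⟨fun θ hθ => ?_, strictAntiOn_areaDiff.mono Set.Ioo_subset_Ioc_self,
    tendsto_areaDiff_zero, ?_⟩
  · have h := strictAntiOn_areaDiff ⟨hθ.1, hθ.2.le⟩ ⟨by positivity, le_rfl⟩ hθ.2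
    rw [areaDiff_pi_div_two] at h
    exact sub_pos.1 h
  · rw [← areaDiff_pi_div_two]
    exact (continuousAt_areaDiff (by simp)).tendsto.mono_left nhdsWithin_le_nhds
end

section
/- Let θ₁, θ₂ ∈ (0, π/2] satisfy θ₁·cot θ₁ = (π − θ₂)·cot θ₂ (interpreting cot(π/2) = 0). Then θ₁/sin θ₁ + cos θ₁ ≥ (π − θ₂)/sin θ₂ − cos θ₂, with equality if and only if θ₁ = θ₂ = π/2. -/
open Real

/-- The derivative of `x cos x / sin x`. -/
theorem hasDerivAt_mul_cos_div_sin {x : ℝ} (hx : sin x ≠ 0) :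
    HasDerivAt (fun x : ℝ => x * cos x / sin x) ((sin x * cos x - x) / sin x ^ 2) x := by
  have h := ((hasDerivAt_id x).mul (hasDerivAt_cos x)).div (hasDerivAt_sin x) hx
  refine h.congr_deriv ?_
  simp only [id, Pi.mul_apply]
  congr 1
  linear_combination (-x) * sin_sq_add_cos_sq x

/-- The function `x cot x` is strictly decreasing on `(0, π/2]`. -/
theorem strictAntiOn_mul_cos_div_sin :
    StrictAntiOn (fun x : ℝ => x * cos x / sin x) (Set.Ioc 0 (π / 2)) := by
  have hsin : ∀ x ∈ Set.Ioc 0 (π / 2), 0 < sin x := fun x hx =>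
    sin_pos_of_pos_of_lt_pi hx.1 (by linarith [hx.2, pi_pos])
  refine strictAntiOn_of_deriv_neg (convex_Ioc _ _) (fun x hx =>
    (hasDerivAt_mul_cos_div_sin (hsin x hx).ne').continuousAt.continuousWithinAt) ?_
  intro x hx
  rw [interior_Ioc] at hx
  have hs := hsin x ⟨hx.1, hx.2.le⟩
  rw [(hasDerivAt_mul_cos_div_sin hs.ne').deriv]
  refine div_neg_of_neg_of_pos ?_ (by positivity)
  nlinarith [sin_lt hx.1, cos_le_one x]

/-- With `L = a cot a`, the function `(L + 1) cos s + s sin s` of `s` is decreasing to the right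
of `a`, where its value is `a / sin a + cos a`. -/
theorem add_one_mul_cos_add_mul_sin_le {a b : ℝ} (ha : 0 < a) (hab : a ≤ b) (hb : b ≤ π / 2) :
    (a * cos a / sin a + 1) * cos b + b * sin b ≤ a / sin a + cos a := by
  have hsin : ∀ x ∈ Set.Icc a b, 0 < sin x := fun x hx =>
    sin_pos_of_pos_of_lt_pi (ha.trans_le hx.1) (by linarith [hx.2, pi_pos])
  set L := a * cos a / sin a with hL
  have hd (s : ℝ) : HasDerivAt (fun s => (L + 1) * cos s + s * sin s)
      (s * cos s - L * sin s) s := by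
    refine (((hasDerivAt_cos s).const_mul (L + 1)).add
      ((hasDerivAt_id s).mul (hasDerivAt_sin s))).congr_deriv ?_
    simp only [id]
    ring
  have hanti : AntitoneOn (fun s => (L + 1) * cos s + s * sin s) (Set.Icc a b) := by
    refine antitoneOn_of_deriv_nonpos (convex_Icc _ _)
      (fun s _ => (hd s).continuousAt.continuousWithinAt)
      (fun s _ => (hd s).differentiableAt.differentiableWithinAt) ?_
    intro s hs
    rw [interior_Icc] at hs
    rw [(hd s).deriv]
    have h := strictAntiOn_mul_cos_div_sin.antitoneOn ⟨ha, hab.trans hb⟩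
      ⟨ha.trans hs.1, hs.2.le.trans hb⟩ hs.1.le
    have h' := (div_le_iff₀ (hsin s ⟨hs.1.le, hs.2.le⟩)).1 h
    linarith
  refine (hanti ⟨le_rfl, hab⟩ ⟨hab, le_rfl⟩ hab).trans_eq ?_
  have hs := (hsin a ⟨le_rfl, hab⟩).ne'
  simp only [hL]
  field_simp
  linear_combination a * sin_sq_add_cos_sq a

theorem upper_halfdisk_area_ge (θ₁ θ₂ : ℝ)
    (h₁ : θ₁ ∈ Set.Ioc 0 (π / 2)) (h₂ : θ₂ ∈ Set.Ioc 0 (π / 2))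
    (hper : θ₁ * Real.cot θ₁ = (π - θ₂) * Real.cot θ₂) :
    θ₁ / Real.sin θ₁ + Real.cos θ₁ ≥ (π - θ₂) / Real.sin θ₂ - Real.cos θ₂ ∧
    (θ₁ / Real.sin θ₁ + Real.cos θ₁ = (π - θ₂) / Real.sin θ₂ - Real.cos θ₂ ↔
      θ₁ = π / 2 ∧ θ₂ = π / 2) := by
  have hs₂ : 0 < sin θ₂ := sin_pos_of_pos_of_lt_pi h₂.1 (by linarith [h₂.2, pi_pos])
  have hc₂ : 0 ≤ cos θ₂ := cos_nonneg_of_mem_Icc ⟨by linarith [h₂.1, pi_pos], h₂.2⟩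
  rw [cot_eq_cos_div_sin, cot_eq_cos_div_sin, ← mul_div_assoc, ← mul_div_assoc] at hper
  have hle : θ₁ ≤ θ₂ := by
    rw [← strictAntiOn_mul_cos_div_sin.le_iff_ge h₂ h₁]
    simp only [hper]
    gcongr
    linarith [h₂.2]
  have key := add_one_mul_cos_add_mul_sin_le h₁.1 hle h₂.2
  rw [hper] at key
  have hdiff : ((π - θ₂) * cos θ₂ / sin θ₂ + 1) * cos θ₂ + θ₂ * sin θ₂ =
      (π - θ₂) / sin θ₂ - cos θ₂ + 2 * (cos θ₂ - (π / 2 - θ₂) * sin θ₂) := by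
    field_simp
    linear_combination (π - θ₂) * sin_sq_add_cos_sq θ₂
  rw [hdiff] at key
  rcases h₂.2.eq_or_lt with h | h
  · have h' : θ₁ = π / 2 := by
      refine strictAntiOn_mul_cos_div_sin.injOn h₁ ⟨by positivity, le_rfl⟩ ?_
      simp [hper, h]
    subst h h'
    simp
    linarith
  · have htan : (π / 2 - θ₂) * sin θ₂ < cos θ₂ := by
      have ht := lt_tan (x := π / 2 - θ₂) (by linarith) (by linarith [h₂.1])
      rwa [tan_eq_sin_div_cos, sin_pi_div_two_sub, cos_pi_div_two_sub, lt_div_iff₀ hs₂] at ht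
    exact ⟨by linarith, fun he => by linarith, fun he => absurd he.2 h.ne⟩
end

section
/- Let θ₁, θ₂ ∈ (0, π/2] satisfy θ₁·cot θ₁ = (π − θ₂)·cot θ₂ (interpreting cot(π/2) = 0). Then θ₁ ≤ θ₂. -/
open Real

/-- If `θ₁, θ₂ ∈ (0, π/2]` satisfy the equal-perimeter condition
`θ₁·cot θ₁ = (π − θ₂)·cot θ₂`, then `θ₁ ≤ θ₂`. -/
theorem angle_le_of_equal_perimeter (θ₁ θ₂ : ℝ)
    (h₁ : θ₁ ∈ Set.Ioc 0 (π / 2)) (h₂ : θ₂ ∈ Set.Ioc 0 (π / 2))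
    (hper : θ₁ * Real.cot θ₁ = (π - θ₂) * Real.cot θ₂) :
    θ₁ ≤ θ₂ := by
  obtain ⟨h₁pos, h₁le⟩ := h₁
  obtain ⟨h₂pos, -⟩ := h₂
  by_contra! hlt
  have hsin₂ : 0 < sin θ₂ := sin_pos_of_pos_of_lt_pi h₂pos (by linarith)
  have hsin : sin θ₂ ≤ sin θ₁ := sin_le_sin_of_le_of_le_pi_div_two (by linarith) h₁le hlt.le
  have hcos₂ : 0 < cos θ₂ := cos_pos_of_mem_Ioo ⟨by linarith, by linarith⟩
  have hcos : cos θ₁ ≤ cos θ₂ := cos_le_cos_of_nonneg_of_le_pi h₂pos.le (by linarith) hlt.le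
  have hcot : Real.cot θ₁ ≤ Real.cot θ₂ := by
    rw [Real.cot_eq_cos_div_sin, Real.cot_eq_cos_div_sin]
    exact div_le_div₀ hcos₂.le hcos hsin₂ hsin
  have hcot₂ : 0 < Real.cot θ₂ := by
    rw [Real.cot_eq_cos_div_sin]
    exact div_pos hcos₂ hsin₂
  refine hper.not_lt ?_
  calc θ₁ * Real.cot θ₁ ≤ θ₁ * Real.cot θ₂ := by gcongr
    _ < (π - θ₂) * Real.cot θ₂ := by
      gcongr
      linarith
end

section
/- Let θ₁, θ₂ ∈ (0, π/2) satisfy θ₁·cot θ₁ = (π − θ₂)·cot θ₂. Then θ₁/sin θ₁ + cos θ₁ > (π − θ₂)/sin θ₂ − cos θ₂. -/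
open Real

/-- On `(0, π)` the functions `F t = t / sin t + cos t` and `G t = t * cos t / sin t` satisfy
`F' = cos * G'`, which gives the derivative of `F - k * G`. -/
lemma hasDerivAt_area_sub_mul_perimeter (k : ℝ) {t : ℝ} (ht : sin t ≠ 0) :
    HasDerivAt (fun t => t / sin t + cos t - k * (t * cos t / sin t))
      ((cos t - k) * (sin t * cos t - t) / sin t ^ 2) t := by
  have hF := ((hasDerivAt_id t).div (hasDerivAt_sin t) ht).add (hasDerivAt_cos t)
  have hG := (((hasDerivAt_id t).mul (hasDerivAt_cos t)).div (hasDerivAt_sin t) ht).const_mul k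
  refine (hF.sub hG).congr_deriv ?_
  simp only [id, Pi.mul_apply]
  field_simp
  linear_combination (k * t - sin t) * sin_sq_add_cos_sq t

/-- The area of an upper halfdisk, as a function of its perimeter, lies above its tangent lines. -/
lemma area_sub_mul_perimeter_le {a b : ℝ} (ha : 0 < a) (hab : a ≤ b) (hb : b < π) :
    b / sin b + cos b - cos b * (b * cos b / sin b) ≤
      a / sin a + cos a - cos b * (a * cos a / sin a) := by
  have hsin : ∀ t ∈ Set.Icc a b, 0 < sin t := fun t ht =>
    sin_pos_of_pos_of_lt_pi (ha.trans_le ht.1) (ht.2.trans_lt hb)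
  have hder := fun t ht => hasDerivAt_area_sub_mul_perimeter (cos b) (hsin t ht).ne'
  refine antitoneOn_of_deriv_nonpos (convex_Icc a b)
    (fun t ht => (hder t ht).continuousAt.continuousWithinAt)
    (fun t ht => (hder t (interior_subset ht)).differentiableAt.differentiableWithinAt)
    (fun t ht => ?_) (Set.left_mem_Icc.2 hab) (Set.right_mem_Icc.2 hab) hab
  replace ht := interior_subset ht
  have ht0 : 0 < t := ha.trans_le ht.1
  rw [(hder t ht).deriv]
  have hcos : cos b ≤ cos t := cos_le_cos_of_nonneg_of_le_pi ht0.le hb.le ht.2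
  have hlt : sin t * cos t ≤ t := by nlinarith [sin_lt ht0, hsin t ht, cos_le_one t]
  exact div_nonpos_of_nonpos_of_nonneg
    (mul_nonpos_of_nonneg_of_nonpos (sub_nonneg.2 hcos) (sub_nonpos.2 hlt)) (sq_nonneg _)

/-- If `θ₁, θ₂ ∈ (0, π/2)` satisfy the equal-perimeter condition
`θ₁·cot θ₁ = (π − θ₂)·cot θ₂`, then
`θ₁/sin θ₁ + cos θ₁ > (π − θ₂)/sin θ₂ − cos θ₂`. -/
theorem upper_halfdisk_area_gt (θ₁ θ₂ : ℝ)
    (h₁ : θ₁ ∈ Set.Ioo 0 (π / 2)) (h₂ : θ₂ ∈ Set.Ioo 0 (π / 2))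
    (hper : θ₁ * Real.cot θ₁ = (π - θ₂) * Real.cot θ₂) :
    θ₁ / Real.sin θ₁ + Real.cos θ₁ > (π - θ₂) / Real.sin θ₂ - Real.cos θ₂ := by
  obtain ⟨h₁0, h₁π⟩ := h₁
  obtain ⟨h₂0, h₂π⟩ := h₂
  have hs₁ : 0 < sin θ₁ := sin_pos_of_pos_of_lt_pi h₁0 (by linarith)
  have hs₂ : 0 < sin θ₂ := sin_pos_of_pos_of_lt_pi h₂0 (by linarith)
  have hc₂ : 0 < cos θ₂ := cos_pos_of_mem_Ioo ⟨by linarith, h₂π⟩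
  rw [cot_eq_cos_div_sin, cot_eq_cos_div_sin, ← mul_div_assoc, ← mul_div_assoc] at hper
  have hle : θ₁ ≤ θ₂ := by
    by_contra! hlt
    have hsin : sin θ₂ ≤ sin θ₁ := sin_le_sin_of_le_of_le_pi_div_two (by linarith) h₁π.le hlt.le
    have hcos : cos θ₁ ≤ cos θ₂ := cos_le_cos_of_nonneg_of_le_pi h₂0.le (by linarith) hlt.le
    have hle : θ₁ * cos θ₁ / sin θ₁ ≤ θ₁ * cos θ₂ / sin θ₂ := by gcongr
    have hlt' : θ₁ * cos θ₂ / sin θ₂ < (π - θ₂) * cos θ₂ / sin θ₂ := by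
      gcongr
      linarith
    linarith
  have htangent := area_sub_mul_perimeter_le h₁0 hle (by linarith)
  rw [hper] at htangent
  have htan : (π / 2 - θ₂) * sin θ₂ < cos θ₂ := by
    have h := lt_tan (x := π / 2 - θ₂) (by linarith) (by linarith)
    rwa [tan_eq_sin_div_cos, sin_pi_div_two_sub, cos_pi_div_two_sub, lt_div_iff₀ hs₂] at h
  have hgap : θ₂ / sin θ₂ + cos θ₂ - cos θ₂ * (θ₂ * cos θ₂ / sin θ₂)
      + cos θ₂ * ((π - θ₂) * cos θ₂ / sin θ₂) - ((π - θ₂) / sin θ₂ - cos θ₂)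
      = 2 * (cos θ₂ - (π / 2 - θ₂) * sin θ₂) := by
    field_simp
    linear_combination (π - 2 * θ₂) * sin_sq_add_cos_sq θ₂
  linarith
end

section
/- Let θ₂ ∈ (0, π/2) satisfy (π − θ₂)·cot θ₂ = 1. Then 2 > (π − θ₂)/sin θ₂ − cos θ₂. -/
open Real

/-- If `θ₂ ∈ (0, π/2)` satisfies `(π − θ₂)·cot θ₂ = 1` (equal perimeters of the
horocycle halfdisk above `{y=1}` and the geodesic halfdisk below `{y=c}`), then
`2 > (π − θ₂)/sin θ₂ − cos θ₂`. -/
theorem horocycle_halfdisk_area_gt (θ₂ : ℝ) (h₂ : θ₂ ∈ Set.Ioo 0 (π / 2))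
    (hper : (π - θ₂) * Real.cot θ₂ = 1) :
    2 > (π - θ₂) / Real.sin θ₂ - Real.cos θ₂ := by
  obtain ⟨h0, h1⟩ := h₂
  have hs : 0 < sin θ₂ := sin_pos_of_pos_of_lt_pi h0 (by linarith [pi_pos])
  have hc : 0 < cos θ₂ := cos_pos_of_mem_Ioo ⟨by linarith, h1⟩
  have hsc := sin_sq_add_cos_sq θ₂
  have hs1 := sin_le_one θ₂
  rw [cot_eq_cos_div_sin] at hper
  have hper' : (π - θ₂) * cos θ₂ = sin θ₂ := by
    field_simp at hper
    linarith
  have htan : (π / 2 - θ₂) * sin θ₂ ≤ cos θ₂ := by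
    have h := le_tan (x := π / 2 - θ₂) (by linarith) (by linarith)
    rwa [tan_eq_sin_div_cos, sin_pi_div_two_sub, cos_pi_div_two_sub, le_div_iff₀ hs] at h
  have hdiv : (π - θ₂) / sin θ₂ = 1 / cos θ₂ := by
    rw [div_eq_div_iff hs.ne' hc.ne']
    linarith
  have hquad : 1 - 2 * cos θ₂ ^ 2 ≤ π / 2 * cos θ₂ := by
    have hmul := mul_le_mul_of_nonneg_right htan hc.le
    have hsin : sin θ₂ ^ 2 = (π / 2 - θ₂) * sin θ₂ * cos θ₂ + π / 2 * cos θ₂ * sin θ₂ := by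
      linear_combination -sin θ₂ * hper'
    have hle : π / 2 * cos θ₂ * sin θ₂ ≤ π / 2 * cos θ₂ :=
      mul_le_of_le_one_right (by positivity) hs1
    linarith
  have hlow : 0.4143 < cos θ₂ := by
    by_contra! h
    nlinarith [pi_lt_d4]
  rw [hdiv, gt_iff_lt, sub_lt_iff_lt_add, div_lt_iff₀ hc]
  nlinarith
end

section
/- Let α, θ₂ ∈ (0, π/2) satisfy (1/cos α)·ln(1/sin α + cot α) = (π − θ₂)·cot θ₂. Then 1/sin α + tan α·ln(1/sin α + cot α) ≥ (π − θ₂)/sin θ₂ − cos θ₂. -/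
open Real

/-- For `α ∈ (0, π/2)`, the perimeter-normalising logarithm lies between `cos α` and `cot α`. -/
theorem log_inv_sin_add_cot_mem_Icc {α : ℝ} (hα : α ∈ Set.Ioo 0 (π / 2)) :
    Real.log (1 / Real.sin α + Real.cos α / Real.sin α) ∈
      Set.Icc (Real.cos α) (Real.cos α / Real.sin α) := by
  have hs : 0 < Real.sin α := sin_pos_of_pos_of_lt_pi hα.1 (by linarith [hα.2, pi_pos])
  have hc : 0 < Real.cos α := cos_pos_of_mem_Ioo ⟨by linarith [hα.1, pi_pos], hα.2⟩
  have hsc := Real.sin_sq_add_cos_sq α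
  have hc1 : Real.cos α < 1 := by nlinarith [sq_pos_of_pos hs]
  have hc1' : 0 < 1 - Real.cos α := by linarith
  have hpos : 0 < 1 / Real.sin α + Real.cos α / Real.sin α := by positivity
  constructor
  · have h := sum_range_le_log_div hc.le hc1 1
    have hsq : (1 + Real.cos α) / (1 - Real.cos α) =
        (1 / Real.sin α + Real.cos α / Real.sin α) ^ 2 := by
      field_simp
      linear_combination hsc
    rw [hsq, Real.log_pow] at h
    simpa using h
  · have hsinh : Real.sinh (Real.log (1 / Real.sin α + Real.cos α / Real.sin α)) =
        Real.cos α / Real.sin α := by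
      rw [sinh_log hpos, ← add_div, inv_div]
      field_simp
      linear_combination -hsc
    have h0 : 0 ≤ Real.log (1 / Real.sin α + Real.cos α / Real.sin α) := by
      rw [← sinh_nonneg_iff, hsinh]
      positivity
    exact (self_le_sinh_iff.2 h0).trans_eq hsinh

/-- A geodesic halfdisk of half-perimeter at least `1` satisfies
`(π - θ) (1 - cos θ) ≤ sin θ (1 + cos θ)`. -/
theorem pi_sub_mul_one_sub_cos_le {θ : ℝ} (hθ : θ ∈ Set.Ioo 0 (π / 2))
    (h : Real.sin θ ≤ (π - θ) * Real.cos θ) :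
    (π - θ) * (1 - Real.cos θ) ≤ Real.sin θ * (1 + Real.cos θ) := by
  obtain ⟨w, rfl⟩ : ∃ w, θ = π / 2 - 2 * w := ⟨π / 4 - θ / 2, by ring⟩
  have hw0 : 0 < w := by linarith [hθ.2]
  have hw1 : w < π / 4 := by linarith [hθ.1]
  have hb : 0 < Real.cos w := cos_pos_of_mem_Ioo ⟨by linarith, by linarith⟩
  have hwt : w < Real.tan w := lt_tan hw0 (by linarith)
  have ht1 : Real.tan w < 1 := by
    rw [← tan_pi_div_four]
    exact tan_lt_tan_of_nonneg_of_lt_pi_div_two hw0.le (by linarith) hw1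
  rw [sin_pi_div_two_sub, cos_pi_div_two_sub, cos_two_mul', sin_two_mul] at h ⊢
  have hsin : Real.sin w = Real.tan w * Real.cos w := (tan_mul_cos hb.ne').symm
  have hcos : Real.cos w ^ 2 * (1 + Real.tan w ^ 2) = 1 := by
    have := Real.sin_sq_add_cos_sq w
    rw [hsin] at this
    linear_combination this
  rw [hsin] at h ⊢
  set t := Real.tan w
  set b := Real.cos w
  have hb2 : 0 < b ^ 2 := by positivity
  have hp : π / 2 + 2 * w ≤ 1.575 + 2 * t := by linarith [pi_lt_d2]
  have ht0 : 0 < t := hw0.trans hwt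
  have hper : 1 - t ^ 2 ≤ (π / 2 + 2 * w) * (2 * t) := by
    refine le_of_mul_le_mul_left ?_ hb2
    linear_combination h
  have ht : 0.22 ≤ t := by
    by_contra! hlt
    nlinarith [mul_le_mul_of_nonneg_right hp (by positivity : 0 ≤ 2 * t)]
  have hpoly : (π / 2 + 2 * w) * ((1 - t) * (1 + t ^ 2)) ≤ (1 + t) ^ 3 := by
    have h1 : 0 ≤ (1 - t) * (1 + t ^ 2) := mul_nonneg (by linarith) (by positivity)
    refine (mul_le_mul_of_nonneg_right hp h1).trans ?_
    nlinarith [pow_pos ht0 3, pow_pos ht0 4, mul_nonneg ht0.le (sub_nonneg.2 ht)]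
  have e1 : 1 - 2 * (t * b) * b = b ^ 2 * (1 - t) ^ 2 := by linear_combination -hcos
  have e2 : 1 + 2 * (t * b) * b = b ^ 2 * (1 + t) ^ 2 := by linear_combination -hcos
  have key := mul_le_mul_of_nonneg_left hpoly
    (mul_nonneg (sq_nonneg (b ^ 2)) (sub_nonneg.2 ht1.le))
  rw [e1, e2]
  linear_combination key - (π / 2 + 2 * w) * b ^ 2 * (1 - t) ^ 2 * hcos

/-- If `α, θ₂ ∈ (0, π/2)` satisfy the equal-perimeter condition
`(1/cos α)·ln(1/sin α + cot α) = (π − θ₂)·cot θ₂`, then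
`1/sin α + tan α·ln(1/sin α + cot α) ≥ (π − θ₂)/sin θ₂ − cos θ₂`. -/
theorem equidistant_halfdisk_area_ge (α θ₂ : ℝ)
    (hα : α ∈ Set.Ioo 0 (π / 2)) (h₂ : θ₂ ∈ Set.Ioo 0 (π / 2))
    (hper : 1 / Real.cos α * Real.log (1 / Real.sin α + Real.cos α / Real.sin α) =
      (π - θ₂) * Real.cot θ₂) :
    1 / Real.sin α + Real.tan α * Real.log (1 / Real.sin α + Real.cos α / Real.sin α) ≥
      (π - θ₂) / Real.sin θ₂ - Real.cos θ₂ := by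
  obtain ⟨hl, hu⟩ := log_inv_sin_add_cot_mem_Icc hα
  have hs : 0 < Real.sin α := sin_pos_of_pos_of_lt_pi hα.1 (by linarith [hα.2, pi_pos])
  have hc : 0 < Real.cos α := cos_pos_of_mem_Ioo ⟨by linarith [hα.1, pi_pos], hα.2⟩
  have hs₂ : 0 < Real.sin θ₂ := sin_pos_of_pos_of_lt_pi h₂.1 (by linarith [h₂.2, pi_pos])
  set L := Real.log (1 / Real.sin α + Real.cos α / Real.sin α)
  have hP : 1 ≤ 1 / Real.cos α * L := by
    rw [one_div_mul_eq_div, one_le_div hc]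
    exact hl
  have harea : 1 / Real.cos α * L + 1 ≤ 1 / Real.sin α + Real.tan α * L := by
    rw [le_div_iff₀ hs] at hu
    have h1 : 1 / Real.sin α + Real.tan α * L - (1 / Real.cos α * L + 1) =
        (1 - Real.sin α) * (Real.cos α - L * Real.sin α) / (Real.sin α * Real.cos α) := by
      rw [tan_eq_sin_div_cos]
      field_simp
      ring
    have h2 : 0 ≤ (1 - Real.sin α) * (Real.cos α - L * Real.sin α) / (Real.sin α * Real.cos α) :=
      div_nonneg (mul_nonneg (sub_nonneg.2 (sin_le_one α)) (sub_nonneg.2 hu)) (by positivity)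
    linarith
  refine le_trans ?_ harea
  rw [hper, cot_eq_cos_div_sin] at hP ⊢
  have hgeo : Real.sin θ₂ ≤ (π - θ₂) * Real.cos θ₂ := by
    rwa [← mul_div_assoc, one_le_div hs₂] at hP
  have h := pi_sub_mul_one_sub_cos_le h₂ hgeo
  rw [← mul_div_assoc, sub_le_iff_le_add, div_add_one hs₂.ne', div_add' _ _ _ hs₂.ne',
    div_le_div_iff_of_pos_right hs₂]
  linear_combination h
end

section
/- For every α ∈ (0, π/2), one has ln(1/sin α + cot α) > cos α; moreover the function k(α) = ln(1/sin α + cot α) − cos α is strictly decreasing on (0, π/2) and tends to 0 as α → π/2⁻. -/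
open Real

/-- The auxiliary function `k(α) = ln(1/sin α + cot α) − cos α`. -/
noncomputable def auxK (α : ℝ) : ℝ :=
  Real.log (1 / Real.sin α + Real.cos α / Real.sin α) - Real.cos α

theorem hasDerivAt_auxK {x : ℝ} (hs : 0 < Real.sin x) (hc : 0 ≤ Real.cos x) :
    HasDerivAt auxK (-(Real.cos x ^ 2 / Real.sin x)) x := by
  have hne : 1 / Real.sin x + Real.cos x / Real.sin x ≠ 0 := by positivity
  have hc' : 1 + Real.cos x ≠ 0 := by positivity
  have h := ((((hasDerivAt_const x (1 : ℝ)).fun_div (Real.hasDerivAt_sin x) hs.ne').fun_add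
    ((Real.hasDerivAt_cos x).fun_div (Real.hasDerivAt_sin x) hs.ne')).log hne).fun_sub
    (Real.hasDerivAt_cos x)
  refine h.congr_deriv ?_
  have hsq : Real.cos x ^ 2 = 1 - Real.sin x ^ 2 := Real.cos_sq' x
  have hnum : (0 * Real.sin x - 1 * Real.cos x) / Real.sin x ^ 2 +
      (-Real.sin x * Real.sin x - Real.cos x * Real.cos x) / Real.sin x ^ 2 =
      -(1 + Real.cos x) / Real.sin x ^ 2 := by
    rw [← add_div]
    congr 1
    linear_combination -hsq
  rw [hnum, ← add_div, hsq]
  field_simp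
  ring

theorem strictAntiOn_auxK_Ioc : StrictAntiOn auxK (Set.Ioc 0 (π / 2)) := by
  have hderiv : ∀ x ∈ Set.Ioc 0 (π / 2),
      HasDerivAt auxK (-(Real.cos x ^ 2 / Real.sin x)) x := fun x hx =>
    hasDerivAt_auxK (Real.sin_pos_of_pos_of_lt_pi hx.1 (by linarith [hx.2, Real.pi_pos]))
      (Real.cos_nonneg_of_mem_Icc ⟨by linarith [hx.1, Real.pi_pos], hx.2⟩)
  refine strictAntiOn_of_deriv_neg (convex_Ioc 0 (π / 2))
    (fun x hx => (hderiv x hx).continuousAt.continuousWithinAt) fun x hx => ?_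
  rw [interior_Ioc] at hx
  rw [(hderiv x ⟨hx.1, hx.2.le⟩).deriv]
  have hs : 0 < Real.sin x :=
    Real.sin_pos_of_pos_of_lt_pi hx.1 (by linarith [hx.2, Real.pi_pos])
  have hc : 0 < Real.cos x :=
    Real.cos_pos_of_mem_Ioo ⟨by linarith [hx.1, Real.pi_pos], hx.2⟩
  exact neg_neg_of_pos (by positivity)

theorem auxK_pi_div_two : auxK (π / 2) = 0 := by
  simp [auxK]

/-- For every `α ∈ (0, π/2)` one has `ln(1/sin α + cot α) > cos α`; moreover
`k(α) = ln(1/sin α + cot α) − cos α` is strictly decreasing on `(0, π/2)` and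
tends to `0` as `α → π/2⁻`. -/
theorem auxK_pos_strictAnti_limit :
    (∀ α ∈ Set.Ioo 0 (π / 2),
      Real.log (1 / Real.sin α + Real.cos α / Real.sin α) > Real.cos α) ∧
    StrictAntiOn auxK (Set.Ioo 0 (π / 2)) ∧
    Filter.Tendsto auxK (nhdsWithin (π / 2) (Set.Iio (π / 2))) (nhds 0) := by
  refine ⟨fun α hα => ?_, strictAntiOn_auxK_Ioc.mono Set.Ioo_subset_Ioc_self, ?_⟩
  · have h := strictAntiOn_auxK_Ioc ⟨hα.1, hα.2.le⟩ ⟨by positivity, le_rfl⟩ hα.2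
    rw [auxK_pi_div_two] at h
    exact sub_pos.mp h
  · have h : ContinuousAt auxK (π / 2) :=
      (hasDerivAt_auxK (by simp) (by simp)).continuousAt
    have ht := h.tendsto.mono_left (nhdsWithin_le_nhds (s := Set.Iio (π / 2)))
    rwa [auxK_pi_div_two] at ht
end

section
/- For every α ∈ (0, π/2), one has tan α·ln(1/sin α + cot α) < 1; moreover the function l(α) = tan α·ln(1/sin α + cot α) is strictly increasing on (0, π/2) and tends to 1 as α → π/2⁻. -/
open Real

/-- The auxiliary function `l(α) = tan α·ln(1/sin α + cot α)`. -/
noncomputable def auxL (α : ℝ) : ℝ :=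
  Real.tan α * Real.log (1 / Real.sin α + Real.cos α / Real.sin α)

/-- The derivative of `ln(1/sin x + cot x)` is `-1/sin x`. -/
lemma hasDerivAt_log_inv_sin_add_cot {x : ℝ} (hx : x ∈ Set.Ioc 0 (π / 2)) :
    HasDerivAt (fun y => Real.log (1 / Real.sin y + Real.cos y / Real.sin y))
      (-(1 / Real.sin x)) x := by
  have hs : 0 < Real.sin x := sin_pos_of_pos_of_lt_pi hx.1 (by linarith [hx.2, pi_pos])
  have hc : 0 ≤ Real.cos x := cos_nonneg_of_mem_Icc ⟨by linarith [hx.1, pi_pos], hx.2⟩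
  have hpos : 0 < 1 / Real.sin x + Real.cos x / Real.sin x := by positivity
  have h := ((((hasDerivAt_const x (1 : ℝ)).div (Real.hasDerivAt_sin x) hs.ne').add
    ((Real.hasDerivAt_cos x).div (Real.hasDerivAt_sin x) hs.ne')).log hpos.ne')
  refine h.congr_deriv ?_
  have h1 : 1 + Real.cos x ≠ 0 := by positivity
  simp only [Pi.add_apply, Pi.div_apply]
  rw [← add_div, ← add_div]
  field_simp
  linear_combination -Real.sin_sq_add_cos_sq x

/-- `cos x < ln(1/sin x + cot x)` on `(0, π/2)`. -/
lemma cos_lt_log_inv_sin_add_cot {x : ℝ} (hx : x ∈ Set.Ioo 0 (π / 2)) :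
    Real.cos x < Real.log (1 / Real.sin x + Real.cos x / Real.sin x) := by
  have hd : ∀ y ∈ Set.Ioc 0 (π / 2), HasDerivAt
      (fun y => Real.log (1 / Real.sin y + Real.cos y / Real.sin y) - Real.cos y)
      (-(1 / Real.sin y) - -Real.sin y) y := fun y hy =>
    (hasDerivAt_log_inv_sin_add_cot hy).sub (Real.hasDerivAt_cos y)
  have hanti := strictAntiOn_of_deriv_neg (convex_Ioc 0 (π / 2))
    (fun y hy => (hd y hy).continuousAt.continuousWithinAt) (fun y hy => by
      rw [interior_Ioc] at hy
      have hs : 0 < Real.sin y := sin_pos_of_pos_of_lt_pi hy.1 (by linarith [hy.2, pi_pos])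
      have hc : 0 < Real.cos y := cos_pos_of_mem_Ioo ⟨by linarith [hy.1, pi_pos], hy.2⟩
      rw [(hd y ⟨hy.1, hy.2.le⟩).deriv]
      have : -(1 / Real.sin y) - -Real.sin y = -(Real.cos y ^ 2 / Real.sin y) := by
        field_simp
        linear_combination Real.sin_sq_add_cos_sq y
      rw [this]
      exact neg_neg_of_pos (by positivity))
  have := hanti ⟨hx.1, hx.2.le⟩ ⟨pi_div_two_pos, le_rfl⟩ hx.2
  simp only [sin_pi_div_two, cos_pi_div_two] at this
  norm_num at this
  simpa using this

/-- `ln(1/sin x + cot x) < cot x` on `(0, π/2)`. -/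
lemma log_inv_sin_add_cot_lt_cot {x : ℝ} (hx : x ∈ Set.Ioo 0 (π / 2)) :
    Real.log (1 / Real.sin x + Real.cos x / Real.sin x) < Real.cos x / Real.sin x := by
  have hd : ∀ y ∈ Set.Ioc 0 (π / 2), HasDerivAt
      (fun y => Real.cos y / Real.sin y -
        Real.log (1 / Real.sin y + Real.cos y / Real.sin y))
      ((-Real.sin y * Real.sin y - Real.cos y * Real.cos y) / Real.sin y ^ 2 -
        -(1 / Real.sin y)) y := fun y hy =>
    ((Real.hasDerivAt_cos y).div (Real.hasDerivAt_sin y)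
      (sin_pos_of_pos_of_lt_pi hy.1 (by linarith [hy.2, pi_pos])).ne').sub
      (hasDerivAt_log_inv_sin_add_cot hy)
  have hanti := strictAntiOn_of_deriv_neg (convex_Ioc 0 (π / 2))
    (fun y hy => (hd y hy).continuousAt.continuousWithinAt) (fun y hy => by
      rw [interior_Ioc] at hy
      have hs : 0 < Real.sin y := sin_pos_of_pos_of_lt_pi hy.1 (by linarith [hy.2, pi_pos])
      have hc : 0 < Real.cos y := cos_pos_of_mem_Ioo ⟨by linarith [hy.1, pi_pos], hy.2⟩
      have hs1 : Real.sin y < 1 := by nlinarith [Real.sin_sq_add_cos_sq y]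
      rw [(hd y ⟨hy.1, hy.2.le⟩).deriv]
      have : (-Real.sin y * Real.sin y - Real.cos y * Real.cos y) / Real.sin y ^ 2 -
          -(1 / Real.sin y) = -((1 - Real.sin y) / Real.sin y ^ 2) := by
        field_simp
        linear_combination -Real.sin_sq_add_cos_sq y
      rw [this]
      exact neg_neg_of_pos (div_pos (by linarith) (by positivity)))
  have := hanti ⟨hx.1, hx.2.le⟩ ⟨pi_div_two_pos, le_rfl⟩ hx.2
  simp only [sin_pi_div_two, cos_pi_div_two] at this
  norm_num at this
  simpa using this

lemma tan_mul_log_lt_one {x : ℝ} (hx : x ∈ Set.Ioo 0 (π / 2)) :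
    Real.tan x * Real.log (1 / Real.sin x + Real.cos x / Real.sin x) < 1 := by
  have hs : 0 < Real.sin x := sin_pos_of_pos_of_lt_pi hx.1 (by linarith [hx.2, pi_pos])
  have hc : 0 < Real.cos x := cos_pos_of_mem_Ioo ⟨by linarith [hx.1, pi_pos], hx.2⟩
  calc Real.tan x * Real.log (1 / Real.sin x + Real.cos x / Real.sin x)
      < Real.tan x * (Real.cos x / Real.sin x) :=
        mul_lt_mul_of_pos_left (log_inv_sin_add_cot_lt_cot hx)
          (tan_pos_of_pos_of_lt_pi_div_two hx.1 hx.2)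
    _ = 1 := by rw [tan_eq_sin_div_cos]; field_simp

lemma hasDerivAt_auxL {x : ℝ} (hx : x ∈ Set.Ioo 0 (π / 2)) :
    HasDerivAt auxL
      ((Real.log (1 / Real.sin x + Real.cos x / Real.sin x) - Real.cos x) /
        Real.cos x ^ 2) x := by
  have hs : 0 < Real.sin x := sin_pos_of_pos_of_lt_pi hx.1 (by linarith [hx.2, pi_pos])
  have hc : 0 < Real.cos x := cos_pos_of_mem_Ioo ⟨by linarith [hx.1, pi_pos], hx.2⟩
  refine ((Real.hasDerivAt_tan hc.ne').mul
    (hasDerivAt_log_inv_sin_add_cot ⟨hx.1, hx.2.le⟩)).congr_deriv ?_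
  rw [tan_eq_sin_div_cos]
  generalize Real.log (1 / Real.sin x + Real.cos x / Real.sin x) = L
  field_simp
  ring

/-- For every `α ∈ (0, π/2)` one has `tan α·ln(1/sin α + cot α) < 1`; moreover
`l(α) = tan α·ln(1/sin α + cot α)` is strictly increasing on `(0, π/2)` and
tends to `1` as `α → π/2⁻`. -/
theorem auxL_lt_one_strictMono_limit :
    (∀ α ∈ Set.Ioo 0 (π / 2),
      Real.tan α * Real.log (1 / Real.sin α + Real.cos α / Real.sin α) < 1) ∧
    StrictMonoOn auxL (Set.Ioo 0 (π / 2)) ∧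
    Filter.Tendsto auxL (nhdsWithin (π / 2) (Set.Iio (π / 2))) (nhds 1) := by
  refine ⟨fun α h => tan_mul_log_lt_one h, ?_, ?_⟩
  · refine strictMonoOn_of_deriv_pos (convex_Ioo _ _) (fun x hx => ?_) (fun x hx => ?_)
    · exact (hasDerivAt_auxL hx).continuousAt.continuousWithinAt
    · rw [interior_Ioo] at hx
      have hc := cos_pos_of_mem_Ioo ⟨by linarith [hx.1, pi_pos], hx.2⟩
      rw [(hasDerivAt_auxL hx).deriv]
      exact div_pos (sub_pos.2 (cos_lt_log_inv_sin_add_cot hx)) (pow_pos hc 2)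
  · have hmem : ∀ᶠ x in nhdsWithin (π / 2) (Set.Iio (π / 2)), x ∈ Set.Ioo 0 (π / 2) :=
      Ioo_mem_nhdsLT pi_div_two_pos
    have hsin : Filter.Tendsto Real.sin (nhdsWithin (π / 2) (Set.Iio (π / 2))) (nhds 1) := by
      simpa using (Real.continuous_sin.tendsto (π / 2)).mono_left nhdsWithin_le_nhds
    refine tendsto_of_tendsto_of_tendsto_of_le_of_le' hsin tendsto_const_nhds ?_ ?_
    · filter_upwards [hmem] with x hx
      have hc := cos_pos_of_mem_Ioo ⟨by linarith [hx.1, pi_pos], hx.2⟩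
      have ht := tan_pos_of_pos_of_lt_pi_div_two hx.1 hx.2
      calc Real.sin x = Real.tan x * Real.cos x := (tan_mul_cos hc.ne').symm
        _ ≤ auxL x := mul_le_mul_of_nonneg_left (cos_lt_log_inv_sin_add_cot hx).le ht.le
    · filter_upwards [hmem] with x hx
      exact (tan_mul_log_lt_one hx).le
end
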